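/- Let α > 0. If C' ≥ 0 is such that for every measurable symmetric V : ℝ² → ℝ with [V]_α < ∞, every finite-dimensional complex subspace M of antisymmetric functions in C_c^∞(ℝ²\{0}; ℂ) on which ∫|∇u|² < ∫V|u|² for all nonzero u ∈ M satisfies dim M ≤ C' · [V]_α, then C' ≥ (Γ((1+α)/2) / (2 π^{3/2} Γ(1+α/2))) · ζ(1+α). (Lower bound on the optimal constant in the antisymmetric weak-type weighted CLR inequality.) -/

import Mathlib

open MeasureTheory

/-- The square of the Euclidean norm on `ℝ²`. -/
noncomputable def sqnorm (x : ℝ × ℝ) : ℝ := x.1 ^ 2 + x.2 ^ 2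

/-- Smooth compactly supported functions on `ℝ²` vanishing in a neighbourhood of `0`. -/
def IsTestFun (u : ℝ × ℝ → ℂ) : Prop :=
  ContDiff ℝ (⊤ : ℕ∞) u ∧ HasCompactSupport u ∧ ∀ᶠ x in nhds (0 : ℝ × ℝ), u x = 0

/-- A function on `ℝ²` is antisymmetric if `u(x₁,x₂) = -u(x₂,x₁)`. -/
def Antisym (u : ℝ × ℝ → ℂ) : Prop := ∀ x : ℝ × ℝ, u (x.2, x.1) = -u x

/-- The Dirichlet energy `∫ |∇u|²` on `ℝ²`. -/
noncomputable def gradEnergy (u : ℝ × ℝ → ℂ) : ℝ :=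
  ∫ x : ℝ × ℝ, (‖fderiv ℝ u x (1, 0)‖ ^ 2 + ‖fderiv ℝ u x (0, 1)‖ ^ 2)

/-- A subspace `M` of antisymmetric test functions on which the quadratic form
`u ↦ ∫ |∇u|² - ∫ V |u|²` is negative for all nonzero `u`. -/
def IsVNegativeAnti (V : ℝ × ℝ → ℝ) (M : Submodule ℂ (ℝ × ℝ → ℂ)) : Prop :=
  (∀ u ∈ M, IsTestFun u ∧ Antisym u) ∧
  ∀ u ∈ M, u ≠ 0 → gradEnergy u < ∫ x : ℝ × ℝ, V x * ‖u x‖ ^ 2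
open scoped ENNReal

/-- The weak weighted norm `[V]_α = sup_{t>0} t^{1+α/2} ∫_{{|x|² V(x)₊ > t}} |x|⁻² dx`. -/
noncomputable def weakNorm (α : ℝ) (V : ℝ × ℝ → ℝ) : ℝ≥0∞ :=
  ⨆ (t : ℝ) (_ : 0 < t), ENNReal.ofReal (t ^ (1 + α / 2)) *
    ∫⁻ x in {x : ℝ × ℝ | t < sqnorm x * max (V x) 0}, ENNReal.ofReal (sqnorm x)⁻¹

lemma tangent_le_log_Gamma {x y d : ℝ} (hx : 0 < x) (hy : 0 < y)
    (hd : HasDerivAt (Real.log ∘ Real.Gamma) d x) :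
    Real.log (Real.Gamma x) + d * (y - x) ≤ Real.log (Real.Gamma y) := by
  have hc := Real.convexOn_log_Gamma
  rcases lt_trichotomy x y with h | h | h
  · have := hc.le_slope_of_hasDerivAt (Set.mem_Ioi.2 hx) (Set.mem_Ioi.2 hy) h hd
    rw [slope_def_field, le_div_iff₀ (by linarith)] at this
    simp only [Function.comp] at this
    linarith
  · subst h; simp
  · have := hc.slope_le_of_hasDerivAt (Set.mem_Ioi.2 hy) (Set.mem_Ioi.2 hx) h hd
    rw [slope_def_field, div_le_iff₀ (by linarith)] at this
    simp only [Function.comp] at this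
    linarith

lemma hasDerivAt_log_Gamma_one :
    HasDerivAt (Real.log ∘ Real.Gamma) (-Real.eulerMascheroniConstant) 1 := by
  have h := Real.hasDerivAt_Gamma_one.log (by simp)
  simpa [Function.comp_def] using h

lemma hasDerivAt_log_Gamma_two :
    HasDerivAt (Real.log ∘ Real.Gamma) (1 - Real.eulerMascheroniConstant) 2 := by
  have h := Real.hasDerivAt_Gamma_nat 1
  norm_num at h
  have h2 := h.log (by simp)
  simp only [Real.Gamma_two, div_one] at h2
  refine h2.congr_deriv ?_
  ring

lemma Gamma_three_halves : Real.Gamma (3 / 2) = √Real.pi / 2 := by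
  have := Real.Gamma_add_one (s := 1 / 2) (by norm_num)
  rw [Real.Gamma_one_half_eq] at this
  norm_num at this
  rw [this]; ring

lemma hasDerivAt_log_Gamma_three_halves :
    HasDerivAt (Real.log ∘ Real.Gamma)
      (2 - Real.eulerMascheroniConstant - 2 * Real.log 2) (3 / 2) := by
  have h := (Real.hasDerivAt_Gamma_one_half).log (by rw [Real.Gamma_one_half_eq]; positivity)
  rw [Real.Gamma_one_half_eq] at h
  have h1 : HasDerivAt (fun s : ℝ => Real.log s + Real.log (Real.Gamma s))
      (2 - Real.eulerMascheroniConstant - 2 * Real.log 2) (1 / 2) := by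
    refine ((Real.hasDerivAt_log (by norm_num : (1 / 2 : ℝ) ≠ 0)).add h).congr_deriv ?_
    have : √Real.pi ≠ 0 := by positivity
    field_simp
    ring
  have h2 : HasDerivAt (fun s : ℝ => Real.log (s - 1) + Real.log (Real.Gamma (s - 1)))
      (2 - Real.eulerMascheroniConstant - 2 * Real.log 2) (3 / 2) := by
    have h3 : HasDerivAt (fun s : ℝ => s - 1) 1 (3 / 2) := (hasDerivAt_id _).sub_const 1
    have h4 := HasDerivAt.comp (h := fun s : ℝ => s - 1) (3 / 2 : ℝ)
      (by norm_num; norm_num at h1; exact h1) h3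
    simpa [Function.comp_def] using h4
  refine h2.congr_of_eventuallyEq ?_
  filter_upwards [lt_mem_nhds (show (1 : ℝ) < 3 / 2 by norm_num)] with s hs
  have h0 : s - 1 ≠ 0 := by linarith
  have hg : Real.Gamma (s - 1) ≠ 0 := (Real.Gamma_pos_of_pos (by linarith)).ne'
  rw [← Real.log_mul h0 hg, ← Real.Gamma_add_one h0]
  simp

lemma lt_log_pi : (1.1443 : ℝ) < Real.log Real.pi := by
  have he := Real.exp_one_lt_d9
  have he0 := Real.exp_pos 1
  have hpi := Real.pi_gt_d4
  have hlog : Real.log Real.pi = 1 + Real.log (1 + (Real.pi / Real.exp 1 - 1)) := by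
    rw [show 1 + (Real.pi / Real.exp 1 - 1) = Real.pi / Real.exp 1 by ring,
      Real.log_div Real.pi_ne_zero he0.ne', Real.log_exp]
    ring
  have hq : (1.1556 : ℝ) ≤ Real.pi / Real.exp 1 := by
    rw [le_div_iff₀ he0]; linarith
  have h := Real.le_log_one_add_of_nonneg (x := 0.1556) (by norm_num)
  have hm := Real.log_le_log (by norm_num : (0 : ℝ) < 1 + 0.1556)
    (by linarith : 1 + 0.1556 ≤ 1 + (Real.pi / Real.exp 1 - 1))
  rw [hlog]
  norm_num at h hm ⊢
  linarith

lemma two_div_le_log_one_add_sub_log {α : ℝ} (hα : 0 < α) :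
    2 / (2 * α + 1) ≤ Real.log (1 + α) - Real.log α := by
  have h := Real.le_log_one_add_of_nonneg (x := 1 / α) (by positivity)
  rw [← Real.log_div (by positivity) hα.ne', show (1 + α) / α = 1 + 1 / α by field_simp; ring]
  refine le_trans (le_of_eq ?_) h
  field_simp
  ring

lemma log_Gamma_half_add_le {α : ℝ} (hα : 0 < α) (h1 : α ≤ 1) :
    Real.log (Real.Gamma ((1 + α) / 2)) ≤ (1 - α) / 2 * Real.log Real.pi := by
  have hc := Real.convexOn_log_Gamma.2 (Set.mem_Ioi.2 (by norm_num : (0 : ℝ) < 1 / 2))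
    (Set.mem_Ioi.2 one_pos) (sub_nonneg.2 h1) hα.le (by ring)
  simp only [Function.comp, smul_eq_mul, Real.Gamma_one, Real.log_one, mul_zero, add_zero,
    mul_one, Real.Gamma_one_half_eq, Real.log_sqrt Real.pi_pos.le] at hc
  rw [show (1 - α) * (1 / 2) + α = (1 + α) / 2 by ring] at hc
  linarith

lemma log_Gamma_half_add_le' {α : ℝ} (hα : 0 < α) :
    Real.log (Real.Gamma ((1 + α) / 2)) ≤
      Real.log (Real.Gamma (1 + α / 2)) + (Real.log 2 - Real.log α) / 2 := by
  have hc := Real.convexOn_log_Gamma.2 (Set.mem_Ioi.2 (by positivity : (0 : ℝ) < α / 2))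
    (Set.mem_Ioi.2 (by positivity : 0 < 1 + α / 2)) (by norm_num : (0 : ℝ) ≤ 1 / 2)
    (by norm_num : (0 : ℝ) ≤ 1 / 2) (by norm_num)
  simp only [Function.comp, smul_eq_mul] at hc
  rw [show 1 / 2 * (α / 2) + 1 / 2 * (1 + α / 2) = (1 + α) / 2 by ring] at hc
  have hg : Real.log (Real.Gamma (1 + α / 2)) =
      Real.log α - Real.log 2 + Real.log (Real.Gamma (α / 2)) := by
    rw [add_comm, Real.Gamma_add_one (by positivity),
      Real.log_mul (by positivity) (Real.Gamma_pos_of_pos (by positivity)).ne',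
      Real.log_div hα.ne' two_ne_zero]
  linarith

lemma log_Gamma_inequality {α : ℝ} (hα : 0 < α) :
    α / 2 * Real.log α + (1 - α) / 2 * Real.log (1 + α) + Real.log (Real.Gamma ((1 + α) / 2)) ≤
      Real.log Real.pi / 2 + Real.log (Real.Gamma (1 + α / 2)) +
        (1 + α / 2) * Real.log (Real.Gamma (1 + α / (2 + α))) := by
  have hπ := lt_log_pi
  have hγ1 := Real.one_half_lt_eulerMascheroniConstant
  have hγ2 := Real.eulerMascheroniConstant_lt_two_thirds
  have hl1 := Real.log_two_gt_d9
  have hl2 := Real.log_two_lt_d9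
  set γ := Real.eulerMascheroniConstant
  set P := Real.log Real.pi
  have hq : 0 < 1 + α / (2 + α) := by positivity
  have hT := tangent_le_log_Gamma (by norm_num) hq hasDerivAt_log_Gamma_three_halves
  have hG32 : Real.log (Real.Gamma (3 / 2)) = P / 2 - Real.log 2 := by
    rw [Gamma_three_halves, Real.log_div (by positivity) two_ne_zero,
      Real.log_sqrt Real.pi_pos.le]
  rw [hG32] at hT
  have hT' := mul_le_mul_of_nonneg_left hT (by positivity : 0 ≤ 1 + α / 2)
  have e1 : (1 + α / 2) * (P / 2 - Real.log 2 + (2 - γ - 2 * Real.log 2) *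
      (1 + α / (2 + α) - 3 / 2)) = (1 + α / 2) * (P / 2 - Real.log 2) +
      (2 - γ - 2 * Real.log 2) * ((α - 2) / 4) := by
    field_simp; ring
  rw [e1] at hT'
  rcases le_or_gt α (1 / 2) with h | h
  · have hA := log_Gamma_half_add_le hα (by linarith)
    have hB := tangent_le_log_Gamma one_pos (by positivity : 0 < 1 + α / 2)
      hasDerivAt_log_Gamma_one
    have hC := mul_le_mul_of_nonneg_left
      (tangent_le_log_Gamma one_pos hq hasDerivAt_log_Gamma_one)
      (by positivity : 0 ≤ 1 + α / 2)
    have e2 : (1 + α / 2) * (Real.log (Real.Gamma 1) + -γ * (1 + α / (2 + α) - 1)) =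
        -γ * (α / 2) := by
      simp only [Real.Gamma_one, Real.log_one]
      field_simp; ring
    rw [e2] at hC
    simp only [Real.Gamma_one, Real.log_one] at hB
    have hD : Real.log (1 + α) ≤ α := by
      have := Real.log_le_sub_one_of_pos (by positivity : 0 < 1 + α); linarith
    have hE : Real.log α ≤ α - 1 / 2 - Real.log 2 := by
      have := Real.log_le_sub_one_of_pos (by positivity : 0 < 2 * α)
      rw [Real.log_mul two_ne_zero hα.ne'] at this
      linarith
    have hD' := mul_le_mul_of_nonneg_left hD (by linarith : 0 ≤ (1 - α) / 2)
    have hE' := mul_le_mul_of_nonneg_left hE (by linarith : 0 ≤ α / 2)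
    nlinarith
  rcases le_or_gt α 1 with h' | h'
  · have hA := log_Gamma_half_add_le hα h'
    have hB := tangent_le_log_Gamma (by norm_num) (by positivity : 0 < 1 + α / 2)
      hasDerivAt_log_Gamma_three_halves
    rw [hG32] at hB
    have hD : Real.log (1 + α) ≤ Real.log 2 + (α - 1) / 2 := by
      have := Real.log_le_sub_one_of_pos (by positivity : 0 < (1 + α) / 2)
      rw [Real.log_div (by positivity) two_ne_zero] at this
      linarith
    have hE : α * Real.log α ≤ -(1 - α) * Real.log 2 := by
      have := Real.convexOn_mul_log.2 (Set.mem_Ici.2 (by norm_num : (0 : ℝ) ≤ 1 / 2))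
        (Set.mem_Ici.2 zero_le_one) (by linarith : 0 ≤ 2 * (1 - α))
        (by linarith : 0 ≤ 2 * α - 1) (by ring)
      simp only [smul_eq_mul, Real.log_one, one_div, Real.log_inv] at this
      rw [show 2 * (1 - α) * 2⁻¹ + (2 * α - 1) * 1 = α by ring] at this
      linarith
    have hD' := mul_le_mul_of_nonneg_left hD (by linarith : 0 ≤ (1 - α) / 2)
    nlinarith
  have hA := log_Gamma_half_add_le' hα
  have hD' := mul_le_mul_of_nonneg_left (two_div_le_log_one_add_sub_log hα)
    (by linarith : 0 ≤ (α - 1) / 2)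
  have e3 : (α - 1) / 2 * (2 / (2 * α + 1)) = (α - 1) / (2 * α + 1) := by
    field_simp
  rw [e3] at hD'
  rcases le_or_gt α 3 with h3 | h3
  · have h_left : Real.log 2 / 2 - P / 2 + 3 / 2 * (Real.log 2 - P / 2) +
        (2 - γ - 2 * Real.log 2) / 4 ≤ -0.01 := by linarith
    have h_right : Real.log 2 / 2 - P / 2 + 5 / 2 * (Real.log 2 - P / 2) -
        (2 - γ - 2 * Real.log 2) / 4 ≤ 0.1 := by linarith
    have hlin : Real.log 2 / 2 - P / 2 + (1 + α / 2) * (Real.log 2 - P / 2) -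
        (2 - γ - 2 * Real.log 2) * ((α - 2) / 4) ≤ 0.1 * (α - 1) / 2 - 0.01 * (3 - α) / 2 := by
      linarith [mul_le_mul_of_nonneg_left h_left (by linarith : 0 ≤ (3 - α) / 2),
        mul_le_mul_of_nonneg_left h_right (by linarith : 0 ≤ (α - 1) / 2)]
    have : 0.1 * (α - 1) / 2 - 0.01 * (3 - α) / 2 ≤ (α - 1) / (2 * α + 1) := by
      rw [le_div_iff₀ (by positivity)]
      nlinarith
    linarith
  · have hC := mul_le_mul_of_nonneg_left
      (tangent_le_log_Gamma two_pos hq hasDerivAt_log_Gamma_two)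
      (by positivity : 0 ≤ 1 + α / 2)
    have e2 : (1 + α / 2) * (Real.log (Real.Gamma 2) + (1 - γ) * (1 + α / (2 + α) - 2)) =
        -(1 - γ) := by
      simp only [Real.Gamma_two, Real.log_one]
      field_simp; ring
    rw [e2] at hC
    have : 2 / 7 ≤ (α - 1) / (2 * α + 1) := by
      rw [div_le_div_iff₀ (by norm_num) (by positivity)]; linarith
    linarith

lemma add_one_rpow_le_sub {α x : ℝ} (hα : 0 < α) (hx : 0 < x) :
    (x + 1) ^ (-(1 + α)) ≤ (x ^ (-α) - (x + 1) ^ (-α)) / α := by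
  have hx1 : 0 < x + 1 := by linarith
  have h1 : 1 + α / (x + 1) ≤ (x / (x + 1)) ^ (-α) := by
    have hl := Real.log_le_sub_one_of_pos (div_pos hx hx1)
    have he : x / (x + 1) - 1 = -(1 / (x + 1)) := by field_simp; ring
    rw [he] at hl
    rw [Real.rpow_def_of_pos (div_pos hx hx1)]
    have := Real.add_one_le_exp (Real.log (x / (x + 1)) * -α)
    have h2 : α / (x + 1) = 1 / (x + 1) * α := by ring
    nlinarith
  rw [Real.div_rpow hx.le hx1.le, le_div_iff₀ (Real.rpow_pos_of_pos hx1 _)] at h1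
  rw [le_div_iff₀ hα, neg_add, Real.rpow_add hx1, Real.rpow_neg_one]
  have : (1 + α / (x + 1)) * (x + 1) ^ (-α) =
    (x + 1) ^ (-α) + (x + 1)⁻¹ * (x + 1) ^ (-α) * α := by ring
  linarith

lemma tsum_add_one_rpow_le {α : ℝ} (hα : 0 < α) :
    ∑' n : ℕ, ((n : ℝ) + 1) ^ (-(1 + α)) ≤ (1 + α) / α := by
  have hs : ∀ n : ℕ, ∑ i ∈ Finset.range (n + 1), ((i : ℝ) + 1) ^ (-(1 + α)) ≤
      1 + (1 - ((n : ℝ) + 1) ^ (-α)) / α := by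
    intro n
    induction n with
    | zero => simp
    | succ n ih =>
      rw [Finset.sum_range_succ]
      have h := add_one_rpow_le_sub hα (by positivity : (0 : ℝ) < n + 1)
      push_cast
      have e : 1 + (1 - ((n : ℝ) + 1 + 1) ^ (-α)) / α = 1 + (1 - ((n : ℝ) + 1) ^ (-α)) / α +
        (((n : ℝ) + 1) ^ (-α) - ((n : ℝ) + 1 + 1) ^ (-α)) / α := by ring
      rw [e]
      exact add_le_add ih h
  refine Real.tsum_le_of_sum_range_le (fun n => by positivity) fun n => ?_
  refine (Finset.sum_le_sum_of_subset_of_nonneg (Finset.range_mono n.le_succ)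
    fun _ _ _ => by positivity).trans ((hs n).trans ?_)
  have : 0 ≤ ((n : ℝ) + 1) ^ (-α) := by positivity
  rw [show (1 + α) / α = 1 + 1 / α by field_simp; ring]
  gcongr
  linarith

/-- The value of `a` at which the trial function `exp (-|s| / √(1 + α))` has zero energy for
the one-dimensional operator `-d²/ds² + 1 - (a / |s|) ^ (2 / (2 + α))`. -/
noncomputable def criticalCoupling (α : ℝ) : ℝ :=
  α ^ (1 + α / 2) * (1 + α) ^ (-((1 + α) / 2)) /
    (2 * Real.Gamma (1 + α / (2 + α)) ^ (1 + α / 2))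

lemma criticalCoupling_pos {α : ℝ} (hα : 0 < α) : 0 < criticalCoupling α := by
  have : 0 < Real.Gamma (1 + α / (2 + α)) := Real.Gamma_pos_of_pos (by positivity)
  unfold criticalCoupling
  positivity

lemma constant_mul_criticalCoupling_le_one {α : ℝ} (hα : 0 < α) :
    Real.Gamma ((1 + α) / 2) / (2 * Real.pi ^ ((3 : ℝ) / 2) * Real.Gamma (1 + α / 2)) *
      (∑' n : ℕ, ((n : ℝ) + 1) ^ (-(1 + α))) * (4 * Real.pi * criticalCoupling α) ≤ 1 := by
  have g1 : 0 < Real.Gamma ((1 + α) / 2) := Real.Gamma_pos_of_pos (by positivity)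
  have g2 : 0 < Real.Gamma (1 + α / 2) := Real.Gamma_pos_of_pos (by positivity)
  have g3 : 0 < Real.Gamma (1 + α / (2 + α)) := Real.Gamma_pos_of_pos (by positivity)
  have hπ := Real.pi_pos
  have hc := criticalCoupling_pos hα
  have h1α : 0 < 1 + α := by linarith
  have hp : 0 < Real.pi ^ ((3 : ℝ) / 2) := Real.rpow_pos_of_pos hπ _
  have hsub : Real.Gamma ((1 + α) / 2) / (2 * Real.pi ^ ((3 : ℝ) / 2) * Real.Gamma (1 + α / 2)) *
      ((1 + α) / α) * (4 * Real.pi * criticalCoupling α) ≤ 1 := by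
    rw [← Real.log_nonpos_iff (by positivity)]
    unfold criticalCoupling
    have := log_Gamma_inequality hα
    have l4 : Real.log 4 = 2 * Real.log 2 := by
      rw [show (4 : ℝ) = 2 ^ 2 by norm_num, Real.log_pow]; norm_num
    rw [Real.log_mul (by positivity) (by positivity), Real.log_mul (by positivity) (by positivity),
      Real.log_div (by positivity) (by positivity), Real.log_div (by positivity) (by positivity),
      Real.log_mul (by positivity) (by positivity), Real.log_mul (by positivity) (by positivity),
      Real.log_mul (by positivity) (by positivity), Real.log_mul (by positivity) (by positivity),
      Real.log_div (by positivity) (by positivity), Real.log_mul (by positivity) (by positivity),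
      Real.log_mul (by positivity) (by positivity), Real.log_rpow hπ, Real.log_rpow hα,
      Real.log_rpow h1α, Real.log_rpow g3, l4]
    nlinarith
  refine le_trans ?_ hsub
  have := tsum_add_one_rpow_le hα
  gcongr

/-- At `β = (1 + α) ^ (-1/2)`, the trial function has negative energy above the critical
coupling. -/
lemma energy_lt_potential_of_criticalCoupling_lt {α a : ℝ} (hα : 0 < α)
    (ha : criticalCoupling α < a) :
    (1 + ((1 + α) ^ (-(1 / 2) : ℝ)) ^ 2) / (1 + α) ^ (-(1 / 2) : ℝ) <
      a ^ (2 / (2 + α)) * (2 * ((2 * (1 + α) ^ (-(1 / 2) : ℝ)) ^ (2 / (2 + α) - 1) *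
        Real.Gamma (1 - 2 / (2 + α)))) := by
  have hc := criticalCoupling_pos hα
  have h1α : 0 < 1 + α := by linarith
  have hq : 0 < α / (2 + α) := by positivity
  have hp1 : 1 - 2 / (2 + α) = α / (2 + α) := by field_simp; ring
  have hG := Real.Gamma_pos_of_pos hq
  have hGr : Real.Gamma (1 + α / (2 + α)) = α / (2 + α) * Real.Gamma (α / (2 + α)) := by
    rw [add_comm, Real.Gamma_add_one hq.ne']
  have hβ : 0 < (1 + α) ^ (-(1 / 2) : ℝ) := Real.rpow_pos_of_pos h1α _
  have hlogβ : Real.log ((1 + α) ^ (-(1 / 2) : ℝ)) = -(1 / 2) * Real.log (1 + α) :=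
    Real.log_rpow h1α _
  have hβsq : ((1 + α) ^ (-(1 / 2) : ℝ)) ^ 2 = 1 / (1 + α) := by
    rw [← Real.rpow_natCast, ← Real.rpow_mul h1α.le]
    norm_num
    rw [Real.rpow_neg_one]
  set β := (1 + α) ^ (-(1 / 2) : ℝ)
  rw [hp1]
  have heq : (1 + β ^ 2) / β = criticalCoupling α ^ (2 / (2 + α)) *
      (2 * ((2 * β) ^ (2 / (2 + α) - 1) * Real.Gamma (α / (2 + α)))) := by
    refine Real.log_injOn_pos (Set.mem_Ioi.2 (by positivity)) (Set.mem_Ioi.2 (by positivity)) ?_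
    have hsum : 1 + β ^ 2 = (2 + α) / (1 + α) := by rw [hβsq]; field_simp; ring
    rw [hsum, Real.log_div (by positivity) hβ.ne', Real.log_div (by positivity) (by positivity),
      Real.log_mul (by positivity) (by positivity), Real.log_rpow hc,
      Real.log_mul (by positivity) (by positivity), Real.log_mul (by positivity) (by positivity),
      Real.log_rpow (mul_pos two_pos hβ), Real.log_mul two_ne_zero hβ.ne', hlogβ]
    unfold criticalCoupling
    rw [hGr, Real.log_div (by positivity) (by positivity),
      Real.log_mul (by positivity) (by positivity),
      Real.log_mul (by positivity) (by positivity), Real.log_rpow hα, Real.log_rpow h1α,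
      Real.log_rpow (mul_pos hq hG), Real.log_mul hq.ne' hG.ne',
      Real.log_div (by positivity) (by positivity)]
    field_simp
    ring
  rw [heq]
  have := Real.rpow_lt_rpow hc.le ha (by positivity : 0 < 2 / (2 + α))
  exact mul_lt_mul_of_pos_right this (by positivity)

lemma integral_rpow_abs_mul_exp {p b : ℝ} (hp : p < 1) (hb : 0 < b) :
    ∫ s : ℝ, |s| ^ (-p) * Real.exp (-b * |s|) = 2 * (b ^ (p - 1) * Real.Gamma (1 - p)) := by
  rw [integral_comp_abs (f := fun s => s ^ (-p) * Real.exp (-b * s))]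
  have := Real.integral_rpow_mul_exp_neg_mul_Ioi (a := 1 - p) (by linarith) hb
  rw [show 1 - p - 1 = -p by ring] at this
  simp only [neg_mul]
  rw [this, one_div, Real.inv_rpow hb.le, ← Real.rpow_neg hb.le, neg_sub]

lemma integrable_rpow_abs_mul_exp {p b : ℝ} (hp : p < 1) (hb : 0 < b) :
    Integrable fun s : ℝ => |s| ^ (-p) * Real.exp (-b * |s|) := by
  refine Integrable.of_integral_ne_zero ?_
  rw [integral_rpow_abs_mul_exp hp hb]
  have := Real.Gamma_pos_of_pos (by linarith : 0 < 1 - p)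
  positivity

/-- A strict energy inequality for `exp (-β |s|)` persists for some smooth compactly supported
function. -/
lemma exists_smooth_compactSupport_energy_lt {β : ℝ} (hβ : 0 < β) {W : ℝ → ℝ} (hW : ∀ s, 0 ≤ W s)
    (hWint : Integrable fun s => W s * Real.exp (-(2 * β) * |s|))
    (hlt : (1 + β ^ 2) / β < ∫ s, W s * Real.exp (-(2 * β) * |s|)) :
    ∃ φ : ℝ → ℝ, ContDiff ℝ (⊤ : ℕ∞) φ ∧ HasCompactSupport φ ∧
      ∫ s, (deriv φ s ^ 2 + φ s ^ 2) < ∫ s, W s * φ s ^ 2 := by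
  let χ : ContDiffBump (0 : ℝ) := ⟨1, 2, one_pos, one_lt_two⟩
  have hχ : ContDiff ℝ (⊤ : ℕ∞) χ := χ.contDiff
  have hχd : Differentiable ℝ χ := hχ.differentiable (by simp)
  obtain ⟨K, hK⟩ : ∃ K, ∀ x, |deriv χ x| ≤ K := by
    have hc : HasCompactSupport (deriv χ) := χ.hasCompactSupport.deriv
    obtain ⟨K, hK⟩ := hc.exists_bound_of_continuous (hχ.continuous_deriv (by simp))
    exact ⟨K, hK⟩
  have hK0 : 0 ≤ K := (abs_nonneg _).trans (hK 0)
  let q : ℝ → ℝ → ℝ := fun ε s => √(s ^ 2 + ε ^ 2)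
  let φ : ℝ → ℝ → ℝ := fun ε s => Real.exp (-β * q ε s) * χ (ε * s)
  have hq_abs : ∀ ε s, |s| ≤ q ε s := fun ε s => Real.abs_le_sqrt (by nlinarith [sq_nonneg ε])
  have hexp_le : ∀ ε s, Real.exp (-β * q ε s) ≤ Real.exp (-β * |s|) := fun ε s =>
    Real.exp_le_exp.2 (by nlinarith [hq_abs ε s])
  have hsq : ∀ s : ℝ, Real.exp (-β * |s|) ^ 2 = Real.exp (-(2 * β) * |s|) := fun s => by
    rw [← Real.exp_nat_mul]; congr 1; push_cast; ring
  have hφ_le : ∀ ε s, |φ ε s| ≤ Real.exp (-β * |s|) := fun ε s => by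
    simp only [φ, abs_mul, Real.abs_exp, abs_of_nonneg χ.nonneg]
    calc _ ≤ Real.exp (-β * |s|) * 1 :=
          mul_le_mul (hexp_le ε s) χ.le_one χ.nonneg (Real.exp_pos _).le
      _ = _ := mul_one _
  have hφsq_le : ∀ ε s, φ ε s ^ 2 ≤ Real.exp (-(2 * β) * |s|) := fun ε s => by
    rw [← hsq, ← sq_abs]; exact pow_le_pow_left₀ (abs_nonneg _) (hφ_le ε s) 2
  have hφ_smooth : ∀ ε, 0 < ε → ContDiff ℝ (⊤ : ℕ∞) (φ ε) := fun ε hε => by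
    refine ContDiff.mul (Real.contDiff_exp.comp (contDiff_const.mul ?_))
      (hχ.comp (contDiff_const.mul contDiff_id))
    exact ContDiff.sqrt (by fun_prop) fun s => by positivity
  have hφ_supp : ∀ ε, 0 < ε → HasCompactSupport (φ ε) := fun ε hε => by
    refine HasCompactSupport.mul_left ?_
    exact χ.hasCompactSupport.comp_homeomorph (Homeomorph.mulLeft₀ ε hε.ne')
  have hderiv : ∀ ε, 0 < ε → ∀ s, deriv (φ ε) s ^ 2 ≤
      (β + ε * K) ^ 2 * Real.exp (-(2 * β) * |s|) := fun ε hε s => by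
    have hpos : 0 < s ^ 2 + ε ^ 2 := by positivity
    have hq : HasDerivAt (q ε) (s / q ε s) s := by
      have h : HasDerivAt (fun s : ℝ => s ^ 2 + ε ^ 2) (2 * s) s := by
        simpa using (hasDerivAt_pow 2 s).add_const (ε ^ 2)
      refine (h.sqrt hpos.ne').congr_deriv ?_
      simp only [q]
      field_simp
    have hχs : HasDerivAt (fun s => χ (ε * s)) (deriv χ (ε * s) * ε) s := by
      have h : HasDerivAt (fun s : ℝ => ε * s) ε s := by
        simpa using (hasDerivAt_id s).const_mul ε
      exact (hχd (ε * s)).hasDerivAt.comp s h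
    have hd := ((hq.const_mul (-β)).exp).mul hχs
    have hq0 : 0 < q ε s := Real.sqrt_pos.2 hpos
    have hr : |s / q ε s| ≤ 1 := by
      rw [abs_div, abs_of_pos hq0, div_le_one hq0]; exact hq_abs ε s
    have hb : |deriv (φ ε) s| ≤ (β + ε * K) * Real.exp (-β * |s|) := by
      have hd' : deriv (φ ε) s = Real.exp (-β * q ε s) *
          (-β * (s / q ε s) * χ (ε * s) + deriv χ (ε * s) * ε) := by
        refine Eq.trans hd.deriv ?_
        ring
      rw [hd', abs_mul, Real.abs_exp, mul_comm]
      refine mul_le_mul ?_ (hexp_le ε s) (Real.exp_pos _).le (by positivity)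
      refine (abs_add_le _ _).trans (add_le_add ?_ ?_)
      · rw [abs_mul, abs_mul, abs_neg, abs_of_pos hβ, abs_of_nonneg χ.nonneg, mul_assoc]
        have : |s / q ε s| * χ (ε * s) ≤ 1 :=
          mul_le_one₀ hr χ.nonneg χ.le_one
        nlinarith
      · rw [abs_mul, abs_of_pos hε, mul_comm]
        exact mul_le_mul_of_nonneg_left (hK _) hε.le
    rw [← hsq, ← mul_pow, ← sq_abs]
    exact pow_le_pow_left₀ (abs_nonneg _) hb 2
  have hexp_int : Integrable fun s : ℝ => Real.exp (-(2 * β) * |s|) := by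
    simpa using integrable_rpow_abs_mul_exp zero_lt_one (by positivity : 0 < 2 * β)
  have hexp_eq : ∫ s : ℝ, Real.exp (-(2 * β) * |s|) = 1 / β := by
    have := integral_rpow_abs_mul_exp zero_lt_one (by positivity : 0 < 2 * β)
    simp only [neg_zero, Real.rpow_zero, one_mul, zero_sub, Real.rpow_neg_one, sub_zero,
      Real.Gamma_one] at this
    rw [this]
    field_simp
  have hkin : ∀ ε, 0 < ε → ∫ s, (deriv (φ ε) s ^ 2 + φ ε s ^ 2) ≤
      ((β + ε * K) ^ 2 + 1) / β := fun ε hε => by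
    calc ∫ s, (deriv (φ ε) s ^ 2 + φ ε s ^ 2)
        ≤ ∫ s, ((β + ε * K) ^ 2 + 1) * Real.exp (-(2 * β) * |s|) := by
          refine integral_mono_of_nonneg (.of_forall fun s => by positivity)
            (hexp_int.const_mul _) (.of_forall fun s => ?_)
          have h1 := hderiv ε hε s
          have h2 := hφsq_le ε s
          simp only
          linarith
      _ = _ := by rw [integral_const_mul, hexp_eq]; ring
  have hpot : Filter.Tendsto (fun ε => ∫ s, W s * φ ε s ^ 2) (nhdsWithin 0 (Set.Ioi 0))
      (nhds (∫ s, W s * Real.exp (-(2 * β) * |s|))) := by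
    have hWm : AEStronglyMeasurable W := by
      have := hWint.aestronglyMeasurable.mul
        (by fun_prop : Continuous fun s : ℝ => Real.exp (2 * β * |s|)).aestronglyMeasurable
      refine this.congr (.of_forall fun s => ?_)
      simp only [Pi.mul_apply]
      rw [mul_assoc, ← Real.exp_add, neg_mul, neg_add_cancel, Real.exp_zero, mul_one]
    refine tendsto_integral_filter_of_dominated_convergence _ ?_ ?_ hWint ?_
    · filter_upwards [self_mem_nhdsWithin] with ε hε
      exact hWm.mul (((hφ_smooth ε hε).continuous.pow 2).aestronglyMeasurable)
    · refine .of_forall fun ε => .of_forall fun s => ?_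
      rw [Real.norm_of_nonneg (mul_nonneg (hW s) (sq_nonneg _))]
      exact mul_le_mul_of_nonneg_left (hφsq_le ε s) (hW s)
    · refine .of_forall fun s => ?_
      have hcont : Continuous fun ε => W s * φ ε s ^ 2 := by
        have := hχ.continuous
        fun_prop
      have h0 := hcont.tendsto 0
      have he : W s * φ 0 s ^ 2 = W s * Real.exp (-(2 * β) * |s|) := by
        have : χ (0 : ℝ) = 1 := χ.one_of_mem_closedBall (by simp [χ])
        rw [← hsq]
        simp [φ, q, Real.sqrt_sq_eq_abs, this]
      rw [he] at h0
      exact h0.mono_left nhdsWithin_le_nhds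
  have hkin_lim : Filter.Tendsto (fun ε : ℝ => ((β + ε * K) ^ 2 + 1) / β)
      (nhdsWithin 0 (Set.Ioi 0)) (nhds ((1 + β ^ 2) / β)) := by
    have hcont : Continuous fun ε : ℝ => ((β + ε * K) ^ 2 + 1) / β := by fun_prop
    have h0 := hcont.tendsto 0
    rw [show ((β + 0 * K) ^ 2 + 1) / β = (1 + β ^ 2) / β by ring] at h0
    exact h0.mono_left nhdsWithin_le_nhds
  obtain ⟨ε, hε, hε0⟩ := ((hkin_lim.eventually_lt hpot hlt).and self_mem_nhdsWithin).exists
  exact ⟨φ ε, hφ_smooth ε hε0, hφ_supp ε hε0, (hkin ε hε0).trans_lt hε⟩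

lemma sqnorm_pos {x : ℝ × ℝ} (hx : x ≠ 0) : 0 < sqnorm x := by
  have : x.1 ≠ 0 ∨ x.2 ≠ 0 := by
    by_contra! h
    exact hx (Prod.ext h.1 h.2)
  unfold sqnorm
  rcases this with h | h <;> positivity

lemma sqnorm_polar (r θ : ℝ) : sqnorm (r * Real.cos θ, r * Real.sin θ) = r ^ 2 := by
  simp only [sqnorm]
  linear_combination r ^ 2 * Real.sin_sq_add_cos_sq θ

lemma log_sqnorm_polar {r : ℝ} (θ : ℝ) :
    Real.log (sqnorm (r * Real.cos θ, r * Real.sin θ)) / 2 = Real.log r := by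
  rw [sqnorm_polar, Real.log_pow]
  push_cast
  ring

lemma integral_inv_mul_comp_log (h : ℝ → ℝ) :
    ∫ r in Set.Ioi (0 : ℝ), r⁻¹ * h (Real.log r) = ∫ s, h s := by
  rw [← Real.range_exp, ← Set.image_univ, integral_image_eq_integral_abs_deriv_smul
    MeasurableSet.univ (fun x _ => (Real.hasDerivAt_exp x).hasDerivWithinAt)
    Real.exp_injective.injOn, setIntegral_univ]
  refine integral_congr_ae (.of_forall fun s => ?_)
  simp [abs_of_pos (Real.exp_pos s)]

lemma lintegral_inv_mul_comp_log (h : ℝ → ℝ≥0∞) :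
    ∫⁻ r in Set.Ioi (0 : ℝ), ENNReal.ofReal r⁻¹ * h (Real.log r) = ∫⁻ s, h s := by
  rw [← Real.range_exp, ← Set.image_univ, lintegral_image_eq_lintegral_abs_deriv_mul
    MeasurableSet.univ (fun x _ => (Real.hasDerivAt_exp x).hasDerivWithinAt)
    Real.exp_injective.injOn, setLIntegral_univ]
  refine lintegral_congr fun s => ?_
  rw [← mul_assoc, ← ENNReal.ofReal_mul (abs_nonneg _), abs_of_pos (Real.exp_pos s),
    mul_inv_cancel₀ (Real.exp_pos s).ne', Real.log_exp, ENNReal.ofReal_one, one_mul]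

/-- Integration in logarithmic polar coordinates. -/
lemma integral_log_polar (h : ℝ → ℝ) (k : ℝ × ℝ → ℝ)
    (hk : ∀ r, 0 < r → ∀ θ, k (r * Real.cos θ, r * Real.sin θ) = k (Real.cos θ, Real.sin θ)) :
    ∫ x : ℝ × ℝ, (sqnorm x)⁻¹ * h (Real.log (sqnorm x) / 2) * k x =
      (∫ s, h s) * ∫ θ in Set.Ioo (-Real.pi) Real.pi, k (Real.cos θ, Real.sin θ) := by
  rw [← integral_comp_polarCoord_symm, ← integral_inv_mul_comp_log h]
  have := setIntegral_prod_mul (μ := (volume : Measure ℝ)) (ν := (volume : Measure ℝ))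
    (fun r : ℝ => r⁻¹ * h (Real.log r)) (fun θ : ℝ => k (Real.cos θ, Real.sin θ))
    (Set.Ioi 0) (Set.Ioo (-Real.pi) Real.pi)
  rw [← this, ← Measure.volume_eq_prod]
  refine setIntegral_congr_fun (measurableSet_Ioi.prod measurableSet_Ioo) fun x hx => ?_
  have hr : 0 < x.1 := hx.1
  simp only [polarCoord_symm_apply, smul_eq_mul]
  rw [log_sqnorm_polar, hk _ hr, sqnorm_polar]
  field_simp

lemma lintegral_log_polar {h : ℝ → ℝ≥0∞} (hh : Measurable h) :
    ∫⁻ x : ℝ × ℝ, ENNReal.ofReal (sqnorm x)⁻¹ * h (Real.log (sqnorm x) / 2) =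
      (∫⁻ s, h s) * ENNReal.ofReal (2 * Real.pi) := by
  rw [← lintegral_comp_polarCoord_symm, ← lintegral_inv_mul_comp_log h]
  have hv : ENNReal.ofReal (2 * Real.pi) =
      ∫⁻ _ in Set.Ioo (-Real.pi) Real.pi, (1 : ℝ≥0∞) := by
    rw [setLIntegral_one, Real.volume_Ioo]; congr 1; ring
  have hm : Measurable fun r : ℝ => ENNReal.ofReal r⁻¹ * h (Real.log r) := by fun_prop
  rw [hv, ← lintegral_prod_mul hm.aemeasurable aemeasurable_const, Measure.prod_restrict,
    ← Measure.volume_eq_prod]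
  refine setLIntegral_congr_fun (measurableSet_Ioi.prod measurableSet_Ioo) fun x hx => ?_
  have hr : 0 < x.1 := hx.1
  simp only [polarCoord_symm_apply, smul_eq_mul, mul_one]
  rw [log_sqnorm_polar, sqnorm_polar, ← mul_assoc, ← ENNReal.ofReal_mul hr.le]
  congr 2
  field_simp

lemma measurable_sqnorm : Measurable sqnorm := by
  unfold sqnorm
  fun_prop

/-- The potential `|x|⁻² (a / |log |x||) ^ (2 / (2 + α))`. -/
noncomputable def logPotential (α a : ℝ) (x : ℝ × ℝ) : ℝ :=
  (sqnorm x)⁻¹ * (a / |Real.log (sqnorm x) / 2|) ^ (2 / (2 + α))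

lemma measurable_logPotential (α a : ℝ) : Measurable (logPotential α a) := by
  have := measurable_sqnorm
  unfold logPotential
  fun_prop

lemma weakNorm_logPotential_le {α a : ℝ} (hα : 0 < α) (ha : 0 < a) :
    weakNorm α (logPotential α a) ≤ ENNReal.ofReal (4 * Real.pi * a) := by
  refine iSup₂_le fun t ht => ?_
  set δ := a * t ^ (-(1 + α / 2)) with hδ
  have hδ0 : 0 < δ := by positivity
  have hsub : ∀ x ∈ {x : ℝ × ℝ | t < sqnorm x * max (logPotential α a x) 0},
      Real.log (sqnorm x) / 2 ∈ Set.Ioo (-δ) δ := by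
    intro x hx
    simp only [Set.mem_ofPred_eq] at hx
    have hx0 : x ≠ 0 := by
      rintro rfl
      simp [sqnorm] at hx
      linarith
    have hs := sqnorm_pos hx0
    have hb : 0 ≤ a / |Real.log (sqnorm x) / 2| := by positivity
    have hV : 0 ≤ logPotential α a x := by unfold logPotential; positivity
    rw [max_eq_left hV, logPotential, mul_inv_cancel_left₀ hs.ne'] at hx
    have h2 := Real.rpow_lt_rpow ht.le hx (by positivity : 0 < 1 + α / 2)
    rw [← Real.rpow_mul hb, show 2 / (2 + α) * (1 + α / 2) = 1 by field_simp,
      Real.rpow_one] at h2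
    have hl : 0 < |Real.log (sqnorm x) / 2| := by
      rcases (abs_nonneg (Real.log (sqnorm x) / 2)).eq_or_lt with h | h
      · rw [← h, div_zero] at h2
        exact absurd h2 (not_lt.2 (by positivity))
      · exact h
    rw [lt_div_iff₀ hl] at h2
    refine abs_lt.1 ?_
    rw [hδ, Real.rpow_neg ht.le, ← div_eq_mul_inv, lt_div_iff₀ (by positivity)]
    linarith
  calc ENNReal.ofReal (t ^ (1 + α / 2)) *
          ∫⁻ x in {x : ℝ × ℝ | t < sqnorm x * max (logPotential α a x) 0},
            ENNReal.ofReal (sqnorm x)⁻¹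
      ≤ ENNReal.ofReal (t ^ (1 + α / 2)) * ∫⁻ x : ℝ × ℝ, ENNReal.ofReal (sqnorm x)⁻¹ *
        (Set.Ioo (-δ) δ).indicator 1 (Real.log (sqnorm x) / 2) := by
        refine mul_le_mul' le_rfl ?_
        have hV := measurable_logPotential α a
        have hq := measurable_sqnorm
        rw [← lintegral_indicator (measurableSet_lt measurable_const (by fun_prop))]
        refine lintegral_mono fun x => ?_
        refine Set.indicator_apply_le' (fun hx => ?_) fun _ => zero_le
        rw [Set.indicator_of_mem (hsub x hx)]
        simp
    _ = ENNReal.ofReal (4 * Real.pi * a) := by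
        rw [lintegral_log_polar (measurable_one.indicator measurableSet_Ioo),
          lintegral_indicator_one measurableSet_Ioo, Real.volume_Ioo,
          ← ENNReal.ofReal_mul (by linarith), ← ENNReal.ofReal_mul (by positivity)]
        congr 1
        rw [hδ, Real.rpow_neg ht.le]
        have : t ^ (1 + α / 2) ≠ 0 := by positivity
        field_simp
        ring

lemma ae_ne_zero_prod : ∀ᵐ x : ℝ × ℝ, x ≠ 0 := by
  simp [ae_iff]

lemma contDiffAt_log_sqnorm {n : WithTop ℕ∞} {x : ℝ × ℝ} (hx : x ≠ 0) :
    ContDiffAt ℝ n (fun y => Real.log (sqnorm y) / 2) x := by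
  have hs : ContDiffAt ℝ n sqnorm x := by
    unfold sqnorm
    fun_prop
  exact (hs.log (sqnorm_pos hx).ne').div_const 2

lemma eventually_log_sqnorm_lt (R : ℝ) :
    ∀ᶠ x in nhds (0 : ℝ × ℝ), x ≠ 0 → Real.log (sqnorm x) / 2 < R := by
  have hc : Continuous sqnorm := by
    unfold sqnorm
    fun_prop
  have h0 : sqnorm 0 < Real.exp (2 * R) := by
    simpa [sqnorm] using Real.exp_pos (2 * R)
  filter_upwards [hc.continuousAt.eventually_lt_const h0] with x hx hx0
  have := (Real.log_lt_iff_lt_exp (sqnorm_pos hx0)).2 hx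
  linarith

lemma exists_eq_zero_of_lt_abs {h : ℝ → ℝ} (hc : HasCompactSupport h) :
    ∃ R, ∀ s, R < |s| → h s = 0 := by
  obtain ⟨R, hR⟩ := hc.isCompact.isBounded.subset_closedBall (0 : ℝ)
  refine ⟨R, fun s hs => image_eq_zero_of_notMem_tsupport fun hm => ?_⟩
  have := mem_closedBall_zero_iff.1 (hR hm)
  rw [Real.norm_eq_abs] at this
  linarith

lemma eventually_comp_log_mul_eq_zero {h : ℝ → ℝ} (hc : HasCompactSupport h) {g : ℝ × ℝ → ℝ}
    (g0 : g 0 = 0) :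
    ∀ᶠ x in nhds (0 : ℝ × ℝ), h (Real.log (sqnorm x) / 2) * g x = 0 := by
  obtain ⟨R, hR⟩ := exists_eq_zero_of_lt_abs hc
  filter_upwards [eventually_log_sqnorm_lt (-|R|)] with x hx
  rcases eq_or_ne x 0 with rfl | hx0
  · rw [g0, mul_zero]
  · have h1 := hx hx0
    rw [hR, zero_mul]
    have := neg_abs_le (Real.log (sqnorm x) / 2)
    linarith [le_abs_self R]

lemma hasCompactSupport_comp_log_mul {h : ℝ → ℝ} (hc : HasCompactSupport h) (g : ℝ × ℝ → ℝ) :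
    HasCompactSupport fun x => h (Real.log (sqnorm x) / 2) * g x := by
  obtain ⟨R, hR⟩ := exists_eq_zero_of_lt_abs hc
  refine HasCompactSupport.intro (isCompact_closedBall (0 : ℝ × ℝ) (Real.exp |R|)) fun x hx => ?_
  rw [mem_closedBall_zero_iff, not_le] at hx
  have hle : ‖x‖ ^ 2 ≤ sqnorm x := by
    unfold sqnorm
    rcases max_choice ‖x.1‖ ‖x.2‖ with h | h <;>
    · rw [Prod.norm_def, h, Real.norm_eq_abs, sq_abs]
      nlinarith [sq_nonneg x.1, sq_nonneg x.2]
  have hlt : Real.exp |R| ^ 2 < sqnorm x :=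
    (pow_lt_pow_left₀ hx (Real.exp_pos _).le two_ne_zero).trans_le hle
  have hlog := Real.log_lt_log (by positivity) hlt
  rw [Real.log_pow, Real.log_exp] at hlog
  push_cast at hlog
  rw [hR, zero_mul]
  have := le_abs_self (Real.log (sqnorm x) / 2)
  linarith [le_abs_self R]

lemma contDiff_comp_log_mul {n : WithTop ℕ∞} {h : ℝ → ℝ} (hh : ContDiff ℝ n h)
    (hc : HasCompactSupport h) {g : ℝ × ℝ → ℝ} (hg : ∀ x ≠ 0, ContDiffAt ℝ n g x)
    (g0 : g 0 = 0) : ContDiff ℝ n fun x => h (Real.log (sqnorm x) / 2) * g x := by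
  refine contDiff_iff_contDiffAt.2 fun x => ?_
  rcases eq_or_ne x 0 with rfl | hx
  · exact contDiffAt_const.congr_of_eventuallyEq (eventually_comp_log_mul_eq_zero hc g0)
  · exact (hh.contDiffAt.comp x (contDiffAt_log_sqnorm hx)).mul (hg x hx)

/-- The antisymmetric trial function with radial profile `φ` in the variable `log |x|` and
angular part `(x₂ - x₁) / |x|`. -/
noncomputable def trialFun (φ : ℝ → ℝ) (x : ℝ × ℝ) : ℝ :=
  φ (Real.log (sqnorm x) / 2) * (Real.exp (-(Real.log (sqnorm x) / 2)) * (x.2 - x.1))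

lemma exp_neg_log_sqnorm_sq {x : ℝ × ℝ} (hx : x ≠ 0) :
    Real.exp (-(Real.log (sqnorm x) / 2)) ^ 2 = (sqnorm x)⁻¹ := by
  rw [← Real.exp_nat_mul, ← Real.exp_log (inv_pos.2 (sqnorm_pos hx)), Real.log_inv]
  congr 1
  push_cast
  ring

lemma contDiff_trialFun {n : WithTop ℕ∞} {φ : ℝ → ℝ} (hφ : ContDiff ℝ n φ)
    (hc : HasCompactSupport φ) : ContDiff ℝ n (trialFun φ) := by
  refine contDiff_comp_log_mul hφ hc (fun x hx => ?_) (by simp)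
  exact (contDiffAt_log_sqnorm hx).neg.exp.mul (by fun_prop)

lemma isTestFun_trialFun {φ : ℝ → ℝ} (hφ : ContDiff ℝ (⊤ : ℕ∞) φ) (hc : HasCompactSupport φ) :
    IsTestFun fun x => (trialFun φ x : ℂ) := by
  refine ⟨Complex.ofRealCLM.contDiff.comp (contDiff_trialFun hφ hc),
    (hasCompactSupport_comp_log_mul hc _).comp_left Complex.ofReal_zero, ?_⟩
  filter_upwards [eventually_comp_log_mul_eq_zero (g := fun x : ℝ × ℝ =>
    Real.exp (-(Real.log (sqnorm x) / 2)) * (x.2 - x.1)) hc (by simp)] with x hx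
  simp only [trialFun, hx, Complex.ofReal_zero]

lemma sqnorm_swap (x : ℝ × ℝ) : sqnorm (x.2, x.1) = sqnorm x :=
  add_comm _ _

lemma antisym_trialFun (φ : ℝ → ℝ) : Antisym fun x => (trialFun φ x : ℂ) := by
  intro x
  simp only [trialFun, sqnorm_swap]
  push_cast
  ring

lemma fderiv_trialFun {φ : ℝ → ℝ} (hφ : ContDiff ℝ 1 φ) (hc : HasCompactSupport φ)
    {x : ℝ × ℝ} (hx : x ≠ 0) (v : ℝ × ℝ) :
    fderiv ℝ (trialFun φ) x v = Real.exp (-(Real.log (sqnorm x) / 2)) *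
      (deriv φ (Real.log (sqnorm x) / 2) * ((x.1 * v.1 + x.2 * v.2) / sqnorm x) * (x.2 - x.1) +
        φ (Real.log (sqnorm x) / 2) *
          (v.2 - v.1 - (x.1 * v.1 + x.2 * v.2) / sqnorm x * (x.2 - x.1))) := by
  have hd : DifferentiableAt ℝ (trialFun φ) x :=
    (contDiff_trialFun hφ hc).differentiable one_ne_zero x
  rw [← hd.lineDeriv_eq_fderiv]
  refine HasLineDerivAt.lineDeriv ?_
  have hs := sqnorm_pos hx
  have h1 : HasDerivAt (fun t : ℝ => x.1 + t * v.1) v.1 0 := by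
    simpa using ((hasDerivAt_id (0 : ℝ)).mul_const v.1).const_add x.1
  have h2 : HasDerivAt (fun t : ℝ => x.2 + t * v.2) v.2 0 := by
    simpa using ((hasDerivAt_id (0 : ℝ)).mul_const v.2).const_add x.2
  have hq : HasDerivAt (fun t : ℝ => sqnorm (x + t • v)) (2 * (x.1 * v.1 + x.2 * v.2)) 0 := by
    refine ((h1.pow 2).add (h2.pow 2)).congr_deriv ?_
    simp
    ring
  have hl : HasDerivAt (fun t : ℝ => Real.log (sqnorm (x + t • v)) / 2)
      ((x.1 * v.1 + x.2 * v.2) / sqnorm x) 0 := by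
    refine ((hq.log (by simpa using hs.ne')).div_const 2).congr_deriv ?_
    simp
    ring
  have hφl : HasDerivAt (fun t : ℝ => φ (Real.log (sqnorm (x + t • v)) / 2))
      (deriv φ (Real.log (sqnorm x) / 2) * ((x.1 * v.1 + x.2 * v.2) / sqnorm x)) 0 := by
    have := (hφ.differentiable one_ne_zero (Real.log (sqnorm x) / 2)).hasDerivAt
    exact HasDerivAt.comp (h := fun t : ℝ => Real.log (sqnorm (x + t • v)) / 2) 0
      (by simpa using this) hl
  refine (hφl.mul (hl.neg.exp.mul (h2.sub h1))).congr_deriv ?_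
  simp
  ring

lemma norm_sq_gradient_trialFun {φ : ℝ → ℝ} (hφ : ContDiff ℝ 1 φ) (hc : HasCompactSupport φ)
    {x : ℝ × ℝ} (hx : x ≠ 0) :
    ‖fderiv ℝ (fun x => (trialFun φ x : ℂ)) x (1, 0)‖ ^ 2 +
        ‖fderiv ℝ (fun x => (trialFun φ x : ℂ)) x (0, 1)‖ ^ 2 =
      (sqnorm x)⁻¹ * deriv φ (Real.log (sqnorm x) / 2) ^ 2 * ((x.2 - x.1) ^ 2 / sqnorm x) +
        (sqnorm x)⁻¹ * φ (Real.log (sqnorm x) / 2) ^ 2 * ((x.1 + x.2) ^ 2 / sqnorm x) := by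
  have hd : DifferentiableAt ℝ (trialFun φ) x :=
    (contDiff_trialFun hφ hc).differentiable one_ne_zero x
  have hf : ∀ v, ‖fderiv ℝ (fun x => (trialFun φ x : ℂ)) x v‖ ^ 2 =
      fderiv ℝ (trialFun φ) x v ^ 2 := by
    intro v
    have : fderiv ℝ (fun x => (trialFun φ x : ℂ)) x =
        Complex.ofRealCLM.comp (fderiv ℝ (trialFun φ) x) :=
      (Complex.ofRealCLM.hasFDerivAt.comp x hd.hasFDerivAt).fderiv
    rw [this]
    simp
  have hs := (sqnorm_pos hx).ne'
  rw [hf, hf, fderiv_trialFun hφ hc hx, fderiv_trialFun hφ hc hx, mul_pow, mul_pow,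
    exp_neg_log_sqnorm_sq hx]
  simp only [mul_one, mul_zero, add_zero, zero_add]
  field_simp
  unfold sqnorm
  ring

lemma integrable_inv_sqnorm_mul {h : ℝ → ℝ} (hh : Continuous h) (hc : HasCompactSupport h)
    {k : ℝ × ℝ → ℝ} (hk : Continuous k) :
    Integrable fun x => (sqnorm x)⁻¹ * h (Real.log (sqnorm x) / 2) * (k x / sqnorm x) := by
  have hg : ∀ x ≠ 0, ContDiffAt ℝ 0 (fun x => (sqnorm x)⁻¹ * (k x / sqnorm x)) x := by
    intro x hx
    have hs : ContDiff ℝ 0 sqnorm := by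
      unfold sqnorm
      fun_prop
    exact (hs.contDiffAt.inv (sqnorm_pos hx).ne').mul
      ((contDiff_zero.2 hk).contDiffAt.div hs.contDiffAt (sqnorm_pos hx).ne')
  have := (contDiff_comp_log_mul (contDiff_zero.2 hh) hc hg
    (by simp [sqnorm])).continuous.integrable_of_hasCompactSupport (μ := volume)
    (hasCompactSupport_comp_log_mul hc _)
  refine this.congr (.of_forall fun x => ?_)
  simp only
  ring

lemma integral_sin_sub_cos_sq :
    ∫ θ in Set.Ioo (-Real.pi) Real.pi, (Real.sin θ - Real.cos θ) ^ 2 = 2 * Real.pi := by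
  rw [← integral_Ioc_eq_integral_Ioo,
    ← intervalIntegral.integral_of_le (by linarith [Real.pi_pos])]
  have : ∀ θ, (Real.sin θ - Real.cos θ) ^ 2 = 1 - 2 * (Real.sin θ * Real.cos θ) := fun θ => by
    linear_combination Real.sin_sq_add_cos_sq θ
  simp only [this]
  rw [intervalIntegral.integral_sub (by simp) (Continuous.intervalIntegrable (by fun_prop) _ _),
    intervalIntegral.integral_const_mul, integral_sin_mul_cos₁]
  simp
  ring

lemma integral_cos_add_sin_sq :
    ∫ θ in Set.Ioo (-Real.pi) Real.pi, (Real.cos θ + Real.sin θ) ^ 2 = 2 * Real.pi := by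
  rw [← integral_Ioc_eq_integral_Ioo,
    ← intervalIntegral.integral_of_le (by linarith [Real.pi_pos])]
  have : ∀ θ, (Real.cos θ + Real.sin θ) ^ 2 = 1 + 2 * (Real.sin θ * Real.cos θ) := fun θ => by
    linear_combination Real.sin_sq_add_cos_sq θ
  simp only [this]
  rw [intervalIntegral.integral_add (by simp) (Continuous.intervalIntegrable (by fun_prop) _ _),
    intervalIntegral.integral_const_mul, integral_sin_mul_cos₁]
  simp
  ring

lemma integral_log_polar_sub_sq (h : ℝ → ℝ) :
    ∫ x : ℝ × ℝ, (sqnorm x)⁻¹ * h (Real.log (sqnorm x) / 2) * ((x.2 - x.1) ^ 2 / sqnorm x) =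
      (∫ s, h s) * (2 * Real.pi) := by
  rw [integral_log_polar h, ← integral_sin_sub_cos_sq]
  · simp [sqnorm]
  · intro r hr θ
    rw [sqnorm_polar]
    simp only [sqnorm, Real.cos_sq_add_sin_sq]
    field_simp

lemma integral_log_polar_add_sq (h : ℝ → ℝ) :
    ∫ x : ℝ × ℝ, (sqnorm x)⁻¹ * h (Real.log (sqnorm x) / 2) * ((x.1 + x.2) ^ 2 / sqnorm x) =
      (∫ s, h s) * (2 * Real.pi) := by
  rw [integral_log_polar h, ← integral_cos_add_sin_sq]
  · simp [sqnorm]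
  · intro r hr θ
    rw [sqnorm_polar]
    simp only [sqnorm, Real.cos_sq_add_sin_sq]
    field_simp

lemma gradEnergy_trialFun {φ : ℝ → ℝ} (hφ : ContDiff ℝ 1 φ) (hc : HasCompactSupport φ) :
    gradEnergy (fun x => (trialFun φ x : ℂ)) =
      (∫ s, (deriv φ s ^ 2 + φ s ^ 2)) * (2 * Real.pi) := by
  have hd : Continuous fun s => deriv φ s ^ 2 := (hφ.continuous_deriv le_rfl).pow 2
  have hφ2 : Continuous fun s => φ s ^ 2 := hφ.continuous.pow 2
  have hdc : HasCompactSupport fun s => deriv φ s ^ 2 :=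
    hc.deriv.comp_left (g := fun y : ℝ => y ^ 2) (by simp)
  have hφc : HasCompactSupport fun s => φ s ^ 2 :=
    hc.comp_left (g := fun y : ℝ => y ^ 2) (by simp)
  rw [gradEnergy, integral_congr_ae
    (ae_ne_zero_prod.mono fun x hx => norm_sq_gradient_trialFun hφ hc hx),
    integral_add (integrable_inv_sqnorm_mul hd hdc (k := fun x => (x.2 - x.1) ^ 2) (by fun_prop))
      (integrable_inv_sqnorm_mul hφ2 hφc (k := fun x => (x.1 + x.2) ^ 2) (by fun_prop)),
    integral_log_polar_sub_sq (fun s => deriv φ s ^ 2),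
    integral_log_polar_add_sq (fun s => φ s ^ 2), ← add_mul,
    integral_add (hd.integrable_of_hasCompactSupport hdc)
      (hφ2.integrable_of_hasCompactSupport hφc)]

lemma integral_logPotential_trialFun (α a : ℝ) (φ : ℝ → ℝ) :
    ∫ x, logPotential α a x * ‖(trialFun φ x : ℂ)‖ ^ 2 =
      (∫ s, (a / |s|) ^ (2 / (2 + α)) * φ s ^ 2) * (2 * Real.pi) := by
  rw [← integral_log_polar_sub_sq fun s => (a / |s|) ^ (2 / (2 + α)) * φ s ^ 2]
  refine integral_congr_ae (ae_ne_zero_prod.mono fun x hx => ?_)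
  simp only
  rw [Complex.norm_real, Real.norm_eq_abs, sq_abs, trialFun, mul_pow, mul_pow,
    exp_neg_log_sqnorm_sq hx, logPotential]
  ring

lemma isVNegativeAnti_span_singleton {V : ℝ × ℝ → ℝ} {u : ℝ × ℝ → ℂ} (hu : IsTestFun u)
    (hua : Antisym u) (hlt : gradEnergy u < ∫ x, V x * ‖u x‖ ^ 2) :
    IsVNegativeAnti V (Submodule.span ℂ {u}) := by
  refine ⟨fun w hw => ?_, fun w hw hw0 => ?_⟩ <;>
    obtain ⟨c, rfl⟩ := Submodule.mem_span_singleton.1 hw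
  · refine ⟨⟨contDiff_const.smul hu.1, hu.2.1.smul_left (f := fun _ => c), ?_⟩, fun x => ?_⟩
    · filter_upwards [hu.2.2] with x hx
      simp [hx]
    · simp [hua x]
  · have hc : 0 < ‖c‖ ^ 2 := by
      have : c ≠ 0 := by
        rintro rfl
        exact hw0 (zero_smul _ _)
      positivity
    have h1 : gradEnergy (c • u) = ‖c‖ ^ 2 * gradEnergy u := by
      unfold gradEnergy
      rw [← integral_const_mul]
      refine integral_congr_ae (.of_forall fun x => ?_)
      have hd : DifferentiableAt ℝ u x := hu.1.differentiable (by simp) x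
      simp only [fderiv_const_smul hd c, smul_apply, norm_smul]
      ring
    have h2 : ∫ x, V x * ‖(c • u) x‖ ^ 2 = ‖c‖ ^ 2 * ∫ x, V x * ‖u x‖ ^ 2 := by
      rw [← integral_const_mul]
      refine integral_congr_ae (.of_forall fun x => ?_)
      simp only [Pi.smul_apply, norm_smul]
      ring
    rw [h1, h2]
    exact mul_lt_mul_of_pos_left hlt hc

lemma one_le_mul_coupling {α C' a : ℝ} (hα : 0 < α) (hC' : 0 ≤ C')
    (hbound : ∀ V : ℝ × ℝ → ℝ, Measurable V → (∀ᵐ x : ℝ × ℝ, V (x.2, x.1) = V x) →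
      weakNorm α V < ⊤ →
      ∀ M : Submodule ℂ (ℝ × ℝ → ℂ), FiniteDimensional ℂ M → IsVNegativeAnti V M →
        (Module.finrank ℂ M : ℝ) ≤ C' * (weakNorm α V).toReal)
    (ha : criticalCoupling α < a) : 1 ≤ C' * (4 * Real.pi * a) := by
  have ha0 : 0 < a := (criticalCoupling_pos hα).trans ha
  have hβ : 0 < (1 + α) ^ (-(1 / 2) : ℝ) := by positivity
  have hp : 2 / (2 + α) < 1 := by
    rw [div_lt_one (by positivity)]
    linarith
  have hen := energy_lt_potential_of_criticalCoupling_lt hα ha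
  set β := (1 + α) ^ (-(1 / 2) : ℝ)
  have hW : (fun s : ℝ => (a / |s|) ^ (2 / (2 + α)) * Real.exp (-(2 * β) * |s|)) =
      fun s => a ^ (2 / (2 + α)) * (|s| ^ (-(2 / (2 + α))) * Real.exp (-(2 * β) * |s|)) := by
    funext s
    rw [Real.div_rpow ha0.le (abs_nonneg s), Real.rpow_neg (abs_nonneg s)]
    ring
  obtain ⟨φ, hφ, hc, hlt⟩ := exists_smooth_compactSupport_energy_lt hβ
    (W := fun s => (a / |s|) ^ (2 / (2 + α))) (fun s => by positivity)
    (by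
      rw [hW]
      exact (integrable_rpow_abs_mul_exp hp (mul_pos two_pos hβ)).const_mul _)
    (by
      rw [hW, integral_const_mul, integral_rpow_abs_mul_exp hp (mul_pos two_pos hβ)]
      exact hen)
  have hgrad : gradEnergy (fun x => (trialFun φ x : ℂ)) <
      ∫ x, logPotential α a x * ‖(trialFun φ x : ℂ)‖ ^ 2 := by
    rw [gradEnergy_trialFun (hφ.of_le (by exact_mod_cast le_top)) hc,
      integral_logPotential_trialFun]
    exact mul_lt_mul_of_pos_right hlt Real.two_pi_pos
  have hne : (fun x => (trialFun φ x : ℂ)) ≠ 0 := by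
    intro h
    simp only [funext_iff, Pi.zero_apply] at h
    simp [gradEnergy, h] at hgrad
  have hnorm := weakNorm_logPotential_le hα ha0
  have hfin := hbound (logPotential α a) (measurable_logPotential α a)
    (.of_forall fun x => by simp only [logPotential, sqnorm_swap])
    (hnorm.trans_lt ENNReal.ofReal_lt_top) _ inferInstance
    (isVNegativeAnti_span_singleton (isTestFun_trialFun hφ hc) (antisym_trialFun φ) hgrad)
  rw [finrank_span_singleton hne, Nat.cast_one] at hfin
  exact hfin.trans (mul_le_mul_of_nonneg_left
    (ENNReal.toReal_le_of_le_ofReal (by positivity) hnorm) hC')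

theorem weak_weighted_CLR_antisymmetric_constant_lower_bound
    (α : ℝ) (hα : 0 < α) (C' : ℝ) (hC' : 0 ≤ C')
    (hbound : ∀ V : ℝ × ℝ → ℝ, Measurable V → (∀ᵐ x : ℝ × ℝ, V (x.2, x.1) = V x) →
      weakNorm α V < ⊤ →
      ∀ M : Submodule ℂ (ℝ × ℝ → ℂ), FiniteDimensional ℂ M → IsVNegativeAnti V M →
        (Module.finrank ℂ M : ℝ) ≤ C' * (weakNorm α V).toReal) :
    Real.Gamma ((1 + α) / 2) / (2 * Real.pi ^ ((3 : ℝ) / 2) * Real.Gamma (1 + α / 2)) *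
      (∑' n : ℕ, ((n : ℝ) + 1) ^ (-(1 + α))) ≤ C' := by
  have hc := criticalCoupling_pos hα
  have hlim : 1 ≤ C' * (4 * Real.pi * criticalCoupling α) := by
    refine ge_of_tendsto (x := nhdsWithin (criticalCoupling α) (Set.Ioi (criticalCoupling α)))
      (f := fun a => C' * (4 * Real.pi * a)) ?_
      (eventually_nhdsWithin_of_forall fun a ha => one_le_mul_coupling hα hC' hbound ha)
    exact (Continuous.tendsto (by fun_prop) _).mono_left nhdsWithin_le_nhds
  exact le_of_mul_le_mul_right ((constant_mul_criticalCoupling_le_one hα).trans hlim)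
    (by positivity)
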